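/- Let 1 ≤ r ≤ n and let p be a size vector of length n. If there exists a maximal pair (A, B) of r-cross-intersecting families in S_p such that the set of coordinates relevant for A or for B has at most r + 2 elements, then there exists a maximal pair (A', B') of r-cross-intersecting families in S_p in which both A' and B' are balls. -/

import Mathlib

open Finset

/-- Families `A`, `B` of vectors in `S_p` (modelled as `∀ i, Fin (p i)`) are
`r`-cross-intersecting: every `x ∈ A` and `y ∈ B` agree in at least `r`
coordinates. -/
def CrossInt {n : ℕ} {p : Fin n → ℕ} (r : ℕ)
    (A B : Finset (∀ i, Fin (p i))) : Prop :=
  ∀ x ∈ A, ∀ y ∈ B, r ≤ (univ.filter (fun i => x i = y i)).card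

/-- `(A, B)` is a maximal `r`-cross-intersecting pair. -/
def MaxPair {n : ℕ} {p : Fin n → ℕ} (r : ℕ)
    (A B : Finset (∀ i, Fin (p i))) : Prop :=
  CrossInt r A B ∧ ∀ A' B' : Finset (∀ i, Fin (p i)),
    CrossInt r A' B' → A'.card * B'.card ≤ A.card * B.card

/-- Coordinate `i` is relevant for `A`: some two vectors differing only in
coordinate `i` are such that one belongs to `A` and the other one does not. -/
def Relevant {n : ℕ} {p : Fin n → ℕ} (A : Finset (∀ i, Fin (p i)))
    (i : Fin n) : Prop :=
  ∃ x y : ∀ j, Fin (p j), (∀ j, j ≠ i → x j = y j) ∧ x ∈ A ∧ y ∉ A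

/-- The Hamming ball of radius `k` around `x₀` in the coordinates `T`. -/
def hBall {n : ℕ} {p : Fin n → ℕ} (T : Finset (Fin n))
    (x₀ : ∀ i, Fin (p i)) (k : ℕ) : Finset (∀ i, Fin (p i)) :=
  univ.filter (fun x => (T.filter (fun i => x i ≠ x₀ i)).card ≤ k)

/-- `A` is a ball: a Hamming ball of some radius around some vector in some
set of coordinates. -/
def IsBall {n : ℕ} {p : Fin n → ℕ} (A : Finset (∀ i, Fin (p i))) : Prop :=
  ∃ (T : Finset (Fin n)) (x₀ : ∀ i, Fin (p i)) (k : ℕ), A = hBall T x₀ k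


/-- Cross-intersection measured only in the coordinates `T`. -/
def TCross {n : ℕ} {p : Fin n → ℕ} (T : Finset (Fin n)) (r : ℕ)
    (A B : Finset (∀ i, Fin (p i))) : Prop :=
  ∀ x ∈ A, ∀ y ∈ B, r ≤ (T.filter (fun i => x i = y i)).card

lemma TCross.symm {n : ℕ} {p : Fin n → ℕ} {T : Finset (Fin n)} {r : ℕ}
    {A B : Finset (∀ i, Fin (p i))} (h : TCross T r A B) : TCross T r B A := by
  intro x hx y hy
  have := h y hy x hx
  simpa only [eq_comm] using this

/-- A family is determined by its relevant coordinates. -/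
lemma mem_of_agree {n : ℕ} {p : Fin n → ℕ} (B : Finset (∀ i, Fin (p i)))
    (T : Finset (Fin n)) (hT : ∀ i, Relevant B i → i ∈ T)
    (y y' : ∀ i, Fin (p i)) (hy : y ∈ B) (h : ∀ i ∈ T, y' i = y i) : y' ∈ B := by
  have key : ∀ s : Finset (Fin n), s.piecewise y' y ∈ B := by
    intro s
    induction s using Finset.induction with
    | empty => simpa using hy
    | insert a s ha ih =>
      rw [Finset.piecewise_insert]
      by_cases haT : a ∈ T
      · rw [h a haT]
        have : Function.update (s.piecewise y' y) a (y a) = s.piecewise y' y := by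
          rw [Function.update_eq_self_iff]
          simp [ha]
        rw [this]; exact ih
      · by_contra hcon
        refine haT (hT a ⟨s.piecewise y' y, _, ?_, ih, hcon⟩)
        intro j hj
        rw [Function.update_of_ne hj]
  have := key univ
  simpa using this

lemma tcross_of_cross {n : ℕ} {p : Fin n → ℕ} (hp : ∀ i, 2 ≤ p i) (r : ℕ)
    (A B : Finset (∀ i, Fin (p i))) (T : Finset (Fin n))
    (hT : ∀ i, Relevant B i → i ∈ T) (h : CrossInt r A B) : TCross T r A B := by
  classical
  intro x hx y hy
  have hne : ∀ i, ∃ v : Fin (p i), x i ≠ v := by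
    intro i
    have : Nontrivial (Fin (p i)) := Fin.nontrivial_iff_two_le.2 (hp i)
    obtain ⟨v, hv⟩ := exists_ne (x i)
    exact ⟨v, hv.symm⟩
  choose w hw using hne
  have hy' : (fun i => if i ∈ T then y i else w i) ∈ B :=
    mem_of_agree B T hT y _ hy (by intro i hi; simp [hi])
  refine (h x hx _ hy').trans (card_le_card ?_)
  intro i hi
  simp only [mem_filter, mem_univ, true_and] at hi ⊢
  by_cases hiT : i ∈ T
  · simp only [hiT, if_true] at hi; exact ⟨hiT, hi⟩
  · simp only [hiT, if_false] at hi; exact absurd hi (hw i)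

section shift
variable {n : ℕ} {p : Fin n → ℕ}

/-- The shift of a single vector. -/
def sh (z : ∀ i, Fin (p i)) (i : Fin n) (v : Fin (p i)) (A : Finset (∀ i, Fin (p i)))
    (x : ∀ i, Fin (p i)) : ∀ i, Fin (p i) :=
  if x i = v ∧ Function.update x i (z i) ∉ A then Function.update x i (z i) else x

lemma sh_injOn (z : ∀ i, Fin (p i)) (i : Fin n) (v : Fin (p i))
    (A : Finset (∀ i, Fin (p i))) : Set.InjOn (sh z i v A) A := by
  intro x hx y hy hxy
  unfold sh at hxy
  split_ifs at hxy with h1 h2 h2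
  · funext j
    by_cases hj : j = i
    · subst hj; rw [h1.1, h2.1]
    · have := congrFun hxy j
      simpa [Function.update_of_ne hj] using this
  · rw [hxy] at h1; exact absurd hy h1.2
  · rw [← hxy] at h2; exact absurd hx h2.2
  · exact hxy

lemma shift_aux (z : ∀ i, Fin (p i)) (T : Finset (Fin n)) (i : Fin n) (v : Fin (p i)) (hv : v ≠ z i)
    (r : ℕ) (A B : Finset (∀ i, Fin (p i))) (h : TCross T r A B)
    (x y : ∀ i, Fin (p i)) (hx : x ∈ A) (hy : y ∈ B) (hxv : x i = v)
    (hyn : ¬ (y i = v ∧ Function.update y i (z i) ∉ B)) :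
    r ≤ (T.filter (fun j => Function.update x i (z i) j = y j)).card := by
  by_cases hyv : y i = v
  · have hyB : Function.update y i (z i) ∈ B := by
      by_contra hc; exact hyn ⟨hyv, hc⟩
    refine (h x hx _ hyB).trans (card_le_card ?_)
    intro j hj
    simp only [mem_filter] at hj ⊢
    refine ⟨hj.1, ?_⟩
    by_cases hji : j = i
    · subst hji
      have := hj.2
      rw [Function.update_self, hxv] at this
      exact absurd this hv
    · have := hj.2
      rw [Function.update_of_ne hji] at this ⊢
      exact this
  · refine (h x hx _ hy).trans (card_le_card ?_)
    intro j hj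
    simp only [mem_filter] at hj ⊢
    refine ⟨hj.1, ?_⟩
    by_cases hji : j = i
    · subst hji
      exact absurd (hj.2.symm.trans hxv) hyv
    · rw [Function.update_of_ne hji]; exact hj.2

lemma shift_cross (z : ∀ i, Fin (p i)) (T : Finset (Fin n)) (i : Fin n) (v : Fin (p i)) (hv : v ≠ z i)
    (r : ℕ) (A B : Finset (∀ i, Fin (p i))) (h : TCross T r A B) :
    TCross T r (A.image (sh z i v A)) (B.image (sh z i v B)) := by
  intro x' hx' y' hy'
  obtain ⟨x, hx, rfl⟩ := mem_image.1 hx'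
  obtain ⟨y, hy, rfl⟩ := mem_image.1 hy'
  unfold sh
  split_ifs with h1 h2 h2
  · refine (h x hx y hy).trans (card_le_card ?_)
    intro j hj
    simp only [mem_filter] at hj ⊢
    refine ⟨hj.1, ?_⟩
    by_cases hji : j = i
    · subst hji; simp
    · rw [Function.update_of_ne hji, Function.update_of_ne hji]; exact hj.2
  · exact shift_aux z T i v hv r A B h x y hx hy h1.1 h2
  · have := shift_aux z T i v hv r B A h.symm y x hy hx h2.1 h1
    simpa only [eq_comm] using this
  · exact h x hx y hy

/-- The potential. -/
def pot (A : Finset (∀ i, Fin (p i))) : ℕ := ∑ x ∈ A, ∑ i, (x i : ℕ)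

lemma sum_update_lt (z : ∀ i, Fin (p i)) (hz : ∀ i, (z i : ℕ) = 0) (i : Fin n)
    (x : ∀ i, Fin (p i)) (hx : x i ≠ z i) :
    ∑ j, (Function.update x i (z i) j : ℕ) < ∑ j, (x j : ℕ) := by
  apply Finset.sum_lt_sum
  · intro j _
    by_cases hji : j = i
    · subst hji; simp [hz]
    · rw [Function.update_of_ne hji]
  · refine ⟨i, mem_univ _, ?_⟩
    rw [Function.update_self, hz]
    have : (x i : ℕ) ≠ (z i : ℕ) := fun hh => hx (Fin.ext hh)
    rw [hz] at this
    omega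

lemma pot_shift_le (z : ∀ i, Fin (p i)) (hz : ∀ i, (z i : ℕ) = 0) (i : Fin n) (v : Fin (p i))
    (hv : v ≠ z i) (A : Finset (∀ i, Fin (p i))) :
    pot (A.image (sh z i v A)) ≤ pot A := by
  unfold pot
  rw [sum_image (sh_injOn z i v A)]
  apply sum_le_sum
  intro x hx
  unfold sh
  split_ifs with h1
  · exact (sum_update_lt z hz i x (by rw [h1.1]; exact hv)).le
  · exact le_rfl

lemma pot_shift_lt (z : ∀ i, Fin (p i)) (hz : ∀ i, (z i : ℕ) = 0) (i : Fin n)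
    (A : Finset (∀ i, Fin (p i))) (x : ∀ i, Fin (p i)) (hx : x ∈ A) (hxi : x i ≠ z i)
    (hu : Function.update x i (z i) ∉ A) :
    pot (A.image (sh z i (x i) A)) < pot A := by
  unfold pot
  rw [sum_image (sh_injOn z i (x i) A)]
  apply sum_lt_sum
  · intro y hy
    unfold sh
    split_ifs with h1
    · exact (sum_update_lt z hz i y (by rw [h1.1]; exact hxi)).le
    · exact le_rfl
  · refine ⟨x, hx, ?_⟩
    unfold sh
    rw [if_pos ⟨rfl, hu⟩]
    exact sum_update_lt z hz i x hxi

/-- Compress until stable. -/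
lemma exists_compressed (z : ∀ i, Fin (p i)) (hz : ∀ i, (z i : ℕ) = 0) (T : Finset (Fin n))
    (r : ℕ) : ∀ (N : ℕ) (A B : Finset (∀ i, Fin (p i))), pot A + pot B = N → TCross T r A B →
    ∃ A' B' : Finset (∀ i, Fin (p i)), A'.card = A.card ∧ B'.card = B.card ∧ TCross T r A' B' ∧
      ∀ x ∈ A', ∀ i, Function.update x i (z i) ∈ A' := by
  intro N
  induction N using Nat.strong_induction_on with
  | _ N ih =>
    intro A B hN h
    by_cases hs : ∀ x ∈ A, ∀ i, Function.update x i (z i) ∈ A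
    · exact ⟨A, B, rfl, rfl, h, hs⟩
    · push Not at hs
      obtain ⟨x, hx, i, hu⟩ := hs
      have hxi : x i ≠ z i := by
        intro hc
        apply hu
        rw [← hc, Function.update_eq_self]; exact hx
      have h1 := pot_shift_lt z hz i A x hx hxi hu
      have h2 := pot_shift_le z hz i (x i) hxi B
      obtain ⟨A', B', hA, hB, hc, hs⟩ := ih _ (by omega) _ _ rfl
        (shift_cross z T i (x i) hxi r A B h)
      refine ⟨A', B', ?_, ?_, hc, hs⟩
      · rw [hA, card_image_of_injOn (sh_injOn z i (x i) A)]
      · rw [hB, card_image_of_injOn (sh_injOn z i (x i) B)]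

/-- The set of coordinates in `T` where `x` differs from `z`. -/
def dif (z : ∀ i, Fin (p i)) (T : Finset (Fin n)) (x : ∀ i, Fin (p i)) : Finset (Fin n) :=
  T.filter (fun i => x i ≠ z i)

/-- After compression, agreements at the value `z` alone suffice. -/
lemma compressed_zero (z : ∀ i, Fin (p i)) (T : Finset (Fin n))
    (r : ℕ) (A B : Finset (∀ i, Fin (p i))) (h : TCross T r A B)
    (hs : ∀ x ∈ A, ∀ i, Function.update x i (z i) ∈ A) (x y : ∀ i, Fin (p i))
    (hx : x ∈ A) (hy : y ∈ B) :
    r + (dif z T x ∪ dif z T y).card ≤ T.card := by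
  have key : ∀ s : Finset (Fin n), s.piecewise z x ∈ A := by
    intro s
    induction s using Finset.induction with
    | empty => simpa using hx
    | insert a s ha ih =>
      rw [Finset.piecewise_insert]
      exact hs _ ih a
  have h1 := h _ (key (univ.filter (fun i => y i ≠ z i))) y hy
  have hd : Disjoint (T.filter (fun i => (univ.filter (fun i => y i ≠ z i)).piecewise z x i = y i))
      (dif z T x ∪ dif z T y) := by
    rw [Finset.disjoint_left]
    intro j hj hj'
    simp only [mem_filter, mem_union, dif, Finset.piecewise, mem_univ, true_and] at hj hj'
    obtain ⟨hjT, hj⟩ := hj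
    by_cases hc : y j = z j
    · rw [if_neg (by simpa using hc)] at hj
      rcases hj' with hj' | hj'
      · exact hj'.2 (hj.trans hc)
      · exact hj'.2 hc
    · rw [if_pos hc] at hj
      exact hc hj.symm
  have h2 := card_union_of_disjoint hd
  have h3 : (T.filter (fun i => (univ.filter (fun i => y i ≠ z i)).piecewise z x i = y i) ∪
      (dif z T x ∪ dif z T y)).card ≤ T.card := by
    apply card_le_card
    intro j hj
    simp only [mem_filter, mem_union, dif] at hj
    tauto
  omega

lemma mem_hBall (z : ∀ i, Fin (p i)) (S : Finset (Fin n)) (k : ℕ) (x : ∀ i, Fin (p i)) :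
    x ∈ hBall S z k ↔ (dif z S x).card ≤ k := by
  simp [hBall, dif]

lemma dif_sdiff (z : ∀ i, Fin (p i)) (T U : Finset (Fin n)) (x : ∀ i, Fin (p i)) :
    dif z (T \ U) x = dif z T x \ U := by
  ext j; simp only [dif, mem_filter, mem_sdiff]; tauto

lemma ball_cross (z : ∀ i, Fin (p i)) (S : Finset (Fin n)) (r a b : ℕ) (h : r + a + b ≤ S.card) :
    CrossInt r (hBall S z a) (hBall S z b) := by
  intro x hx y hy
  rw [mem_hBall] at hx hy
  have h1 : S ⊆ (univ.filter (fun i => x i = y i)) ∪ (dif z S x ∪ dif z S y) := by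
    intro j hj
    simp only [mem_filter, mem_union, dif, mem_univ, true_and]
    by_cases h1 : x j = z j
    · by_cases h2 : y j = z j
      · left; rw [h1, h2]
      · right; right; exact ⟨hj, h2⟩
    · right; left; exact ⟨hj, h1⟩
  have h2 := card_le_card h1
  have h3 := card_union_le (univ.filter (fun i => x i = y i)) (dif z S x ∪ dif z S y)
  have h4 := card_union_le (dif z S x) (dif z S y)
  omega

/-- The conclusion of the extremal analysis. -/
def Good (z : ∀ i, Fin (p i)) (r : ℕ) (A B : Finset (∀ i, Fin (p i))) : Prop :=
  ∃ (S : Finset (Fin n)) (a b : ℕ), r + a + b ≤ S.card ∧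
    A.card * B.card ≤ (hBall S z a).card * (hBall S z b).card

lemma Good.symm {z : ∀ i, Fin (p i)} {r : ℕ} {A B : Finset (∀ i, Fin (p i))}
    (h : Good z r A B) : Good z r B A := by
  obtain ⟨S, a, b, h1, h2⟩ := h
  exact ⟨S, b, a, by omega, by rw [mul_comm, mul_comm (hBall S z b).card]; exact h2⟩

lemma good_of_sub (z : ∀ i, Fin (p i)) (r : ℕ) (A B : Finset (∀ i, Fin (p i)))
    (T U : Finset (Fin n)) (hU : U ⊆ T) (a b : ℕ) (h : r + a + b + U.card ≤ T.card)
    (hA : ∀ x ∈ A, (dif z T x \ U).card ≤ a) (hB : ∀ x ∈ B, (dif z T x \ U).card ≤ b) :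
    Good z r A B := by
  refine ⟨T \ U, a, b, ?_, ?_⟩
  · rw [card_sdiff_of_subset hU]; omega
  · apply Nat.mul_le_mul
    · apply card_le_card; intro x hx; rw [mem_hBall, dif_sdiff]; exact hA x hx
    · apply card_le_card; intro x hx; rw [mem_hBall, dif_sdiff]; exact hB x hx

lemma dif_subset (z : ∀ i, Fin (p i)) (T : Finset (Fin n)) (x : ∀ i, Fin (p i)) :
    dif z T x ⊆ T := filter_subset _ _

/-- The mixed case, settled by comparing two balls. -/
lemma good_mixed (z : ∀ i, Fin (p i)) (r : ℕ) (A B : Finset (∀ i, Fin (p i)))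
    (T U : Finset (Fin n)) (hU : U ⊆ T) (hUc : U.card = 2) (hT : T.card = r + 2)
    (hA : ∀ x ∈ A, (dif z T x).card ≤ 1 ∨ dif z T x ⊆ U)
    (hB : ∀ x ∈ B, (dif z T x).card ≤ 1 ∧ dif z T x ⊆ U) : Good z r A B := by
  classical
  set b1 := hBall T z 1 with hb1
  set b0 := hBall (T \ U) z 0 with hb0
  have m0 : ∀ x, x ∈ b0 ↔ dif z T x ⊆ U := by
    intro x
    rw [hb0, mem_hBall, dif_sdiff, Nat.le_zero, card_eq_zero, sdiff_eq_empty_iff_subset]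
  have m1 : ∀ x, x ∈ b1 ↔ (dif z T x).card ≤ 1 := fun x => mem_hBall z T 1 x
  have hA' : A.card ≤ (b1 ∪ b0).card := by
    apply card_le_card; intro x hx; rw [mem_union, m0, m1]; exact hA x hx
  have hB' : B.card ≤ (b1 ∩ b0).card := by
    apply card_le_card; intro x hx; rw [mem_inter, m0, m1]; exact hB x hx
  have hs := card_union_add_card_inter b1 b0
  have hprod : A.card * B.card ≤ (b1 ∪ b0).card * (b1 ∩ b0).card := Nat.mul_le_mul hA' hB'
  have hi1 : (b1 ∩ b0).card ≤ b1.card := card_le_card inter_subset_left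
  have hi0 : (b1 ∩ b0).card ≤ b0.card := card_le_card inter_subset_right
  obtain ⟨s, hs'⟩ : ∃ s, s = (b1 ∩ b0).card := ⟨_, rfl⟩
  obtain ⟨u, hu⟩ := Nat.exists_eq_add_of_le hi1
  obtain ⟨q, hq⟩ := Nat.exists_eq_add_of_le hi0
  have hun : (b1 ∪ b0).card = s + u + q := by omega
  rw [hun, ← hs'] at hprod
  rw [← hs'] at hu hq
  rcases le_total u q with hc | hc
  · refine ⟨T \ U, 0, 0, ?_, ?_⟩
    · rw [card_sdiff_of_subset hU]; omega
    · rw [← hb0, hq]; nlinarith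
  · refine ⟨T, 1, 1, by omega, ?_⟩
    rw [← hb1, hu]; nlinarith

/-- The case where some member of `A` differs from `z` in two coordinates. -/
lemma good_two (z : ∀ i, Fin (p i)) (r : ℕ) (A B : Finset (∀ i, Fin (p i)))
    (T : Finset (Fin n)) (hT : T.card = r + 2)
    (h : ∀ x ∈ A, ∀ y ∈ B, (dif z T x ∪ dif z T y).card ≤ 2)
    (x₀ : ∀ i, Fin (p i)) (hx₀ : x₀ ∈ A) (h2 : (dif z T x₀).card = 2)
    (y₀ : ∀ i, Fin (p i)) (hy₀ : y₀ ∈ B) (hy : (dif z T y₀).Nonempty) : Good z r A B := by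
  classical
  set U := dif z T x₀ with hU
  have hUT : U ⊆ T := dif_subset z T x₀
  have hBU : ∀ y ∈ B, dif z T y ⊆ U := by
    intro y hyB
    have h1 := h x₀ hx₀ y hyB
    have h3 : U = U ∪ dif z T y := eq_of_subset_of_card_le subset_union_left (by rw [h2]; exact h1)
    rw [h3]; exact subset_union_right
  by_cases hAU : ∀ x ∈ A, dif z T x ⊆ U
  · refine good_of_sub z r A B T U hUT 0 0 (by omega) ?_ ?_
    · intro x hx; rw [sdiff_eq_empty_iff_subset.2 (hAU x hx)]; simp
    · intro x hx; rw [sdiff_eq_empty_iff_subset.2 (hBU x hx)]; simp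
  push Not at hAU
  obtain ⟨x₁, hx₁, hn⟩ := hAU
  obtain ⟨k, hk, hkU⟩ := not_subset.1 hn
  have hB1 : ∀ y ∈ B, (dif z T y).card ≤ 1 := by
    intro y hyB
    by_contra hc
    have h1 := h x₁ hx₁ y hyB
    have h3 : insert k (dif z T y) ⊆ dif z T x₁ ∪ dif z T y := by
      apply insert_subset (mem_union_left _ hk) subset_union_right
    have h4 := card_le_card h3
    rw [card_insert_of_notMem (fun hh => hkU (hBU y hyB hh))] at h4
    omega
  obtain ⟨i, hi⟩ := hy
  have hyi : dif z T y₀ = {i} :=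
    (eq_of_subset_of_card_le (singleton_subset_iff.2 hi) (by simpa using hB1 y₀ hy₀)).symm
  have hiU : i ∈ U := hBU y₀ hy₀ hi
  have hAi : ∀ x ∈ A, (dif z T x ∪ {i}).card ≤ 2 := by
    intro x hx; rw [← hyi]; exact h x hx y₀ hy₀
  by_cases hBi : ∀ y ∈ B, dif z T y ⊆ {i}
  · refine good_of_sub z r A B T {i} (singleton_subset_iff.2 (hUT hiU)) 1 0
      (by rw [card_singleton]; omega) ?_ ?_
    · intro x hx
      have h3 := hAi x hx
      rw [← sdiff_union_self_eq_union, card_union_of_disjoint sdiff_disjoint, card_singleton] at h3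
      omega
    · intro x hx; rw [sdiff_eq_empty_iff_subset.2 (hBi x hx)]; simp
  push Not at hBi
  obtain ⟨y₁, hy₁, hn₁⟩ := hBi
  obtain ⟨j, hj, hji⟩ := not_subset.1 hn₁
  have hyj : dif z T y₁ = {j} :=
    (eq_of_subset_of_card_le (singleton_subset_iff.2 hj) (by simpa using hB1 y₁ hy₁)).symm
  have hjU : j ∈ U := hBU y₁ hy₁ hj
  have hij : i ≠ j := fun hh => hji (by simp [hh])
  have hUij : ({i, j} : Finset (Fin n)) = U := by
    apply eq_of_subset_of_card_le
    · intro a ha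
      simp only [mem_insert, mem_singleton] at ha
      rcases ha with rfl | rfl <;> assumption
    · rw [h2, card_pair hij]
  refine good_mixed z r A B T U hUT h2 hT ?_ (fun y hy => ⟨hB1 y hy, hBU y hy⟩)
  intro x hx
  by_cases hc : (dif z T x).card ≤ 1
  · exact Or.inl hc
  · right
    have a1 : dif z T x = dif z T x ∪ {i} :=
      eq_of_subset_of_card_le subset_union_left ((hAi x hx).trans (by omega))
    have a2 : dif z T x = dif z T x ∪ {j} :=
      eq_of_subset_of_card_le subset_union_left
        ((by rw [← hyj]; exact h x hx y₁ hy₁ : (dif z T x ∪ {j}).card ≤ 2).trans (by omega))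
    have hi' : i ∈ dif z T x := by rw [a1]; simp
    have hj' : j ∈ dif z T x := by rw [a2]; simp
    have hle : (dif z T x).card ≤ 2 := (card_le_card subset_union_left).trans (hAi x hx)
    have : U = dif z T x := by
      apply eq_of_subset_of_card_le
      · rw [← hUij]
        intro a ha
        simp only [mem_insert, mem_singleton] at ha
        rcases ha with rfl | rfl <;> assumption
      · rw [h2]; exact hle
    rw [← this]

lemma good_main (z : ∀ i, Fin (p i)) (r d : ℕ) (A B : Finset (∀ i, Fin (p i)))
    (T : Finset (Fin n)) (hT : T.card = r + d) (hd : d ≤ 2)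
    (hAne : A.Nonempty) (hBne : B.Nonempty)
    (h : ∀ x ∈ A, ∀ y ∈ B, (dif z T x ∪ dif z T y).card ≤ d) : Good z r A B := by
  classical
  have hA : ∀ x ∈ A, (dif z T x).card ≤ d := by
    intro x hx
    obtain ⟨y, hy⟩ := hBne
    exact (card_le_card subset_union_left).trans (h x hx y hy)
  have hB : ∀ y ∈ B, (dif z T y).card ≤ d := by
    intro y hy
    obtain ⟨x, hx⟩ := hAne
    exact (card_le_card subset_union_right).trans (h x hx y hy)
  have h' : ∀ y ∈ B, ∀ x ∈ A, (dif z T y ∪ dif z T x).card ≤ d := by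
    intro y hy x hx; rw [union_comm]; exact h x hx y hy
  by_cases hB0 : ∀ y ∈ B, dif z T y = ∅
  · refine good_of_sub z r A B T ∅ (empty_subset _) d 0 (by rw [card_empty]; omega) ?_ ?_
    · intro x hx; rw [sdiff_empty]; exact hA x hx
    · intro x hx; rw [hB0 x hx]; simp
  by_cases hA0 : ∀ x ∈ A, dif z T x = ∅
  · refine good_of_sub z r A B T ∅ (empty_subset _) 0 d (by rw [card_empty]; omega) ?_ ?_
    · intro x hx; rw [hA0 x hx]; simp
    · intro x hx; rw [sdiff_empty]; exact hB x hx
  push Not at hA0 hB0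
  obtain ⟨x₀, hx₀, hx⟩ := hA0
  obtain ⟨y₀, hy₀, hy⟩ := hB0
  by_cases hd2 : d = 2
  · subst hd2
    by_cases a2 : ∃ x ∈ A, (dif z T x).card = 2
    · obtain ⟨x, hx, hx2⟩ := a2
      exact good_two z r A B T hT h x hx hx2 y₀ hy₀ hy
    by_cases b2 : ∃ x ∈ B, (dif z T x).card = 2
    · obtain ⟨y, hy, hy2⟩ := b2
      exact (good_two z r B A T hT h' y hy hy2 x₀ hx₀ hx).symm
    push Not at a2 b2
    refine good_of_sub z r A B T ∅ (empty_subset _) 1 1 (by rw [card_empty]; omega) ?_ ?_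
    · intro x hx; rw [sdiff_empty]; have := hA x hx; have := a2 x hx; omega
    · intro x hx; rw [sdiff_empty]; have := hB x hx; have := b2 x hx; omega
  · have hx1 := hA x₀ hx₀
    have hx2 := card_pos.2 hx
    have hy2 := card_pos.2 hy
    have hd1 : d = 1 := by omega
    subst hd1
    have hBs : ∀ y ∈ B, dif z T y ⊆ dif z T x₀ := by
      intro y hy
      have : dif z T x₀ = dif z T x₀ ∪ dif z T y :=
        eq_of_subset_of_card_le subset_union_left ((h x₀ hx₀ y hy).trans hx2)
      rw [this]; exact subset_union_right
    have hAs : ∀ x ∈ A, dif z T x ⊆ dif z T x₀ := by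
      intro x hx
      have : dif z T y₀ = dif z T x ∪ dif z T y₀ :=
        eq_of_subset_of_card_le subset_union_right ((h x hx y₀ hy₀).trans hy2)
      refine Subset.trans ?_ (hBs y₀ hy₀)
      rw [this]; exact subset_union_left
    refine good_of_sub z r A B T (dif z T x₀) (dif_subset z T x₀) 0 0 (by omega) ?_ ?_
    · intro x hx; rw [sdiff_eq_empty_iff_subset.2 (hAs x hx)]; simp
    · intro x hx; rw [sdiff_eq_empty_iff_subset.2 (hBs x hx)]; simp

end shift

open scoped Classical in
/-- Theorem 8, part 1: if there exists a maximal pair of `r`-cross-intersecting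
families in `S_p` with at most `r + 2` relevant coordinates, then there exists
such a pair consisting of balls. -/
theorem theorem8_part1 {n : ℕ} (r : ℕ) (hr : 1 ≤ r) (hrn : r ≤ n)
    (p : Fin n → ℕ) (hp : ∀ i, 2 ≤ p i)
    (A B : Finset (∀ i, Fin (p i))) (hAB : MaxPair r A B)
    (hrel : (univ.filter (fun i => Relevant A i ∨ Relevant B i)).card ≤ r + 2) :
    ∃ A' B' : Finset (∀ i, Fin (p i)),
      MaxPair r A' B' ∧ IsBall A' ∧ IsBall B' := by
  obtain ⟨hcross, hmax⟩ := hAB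
  obtain ⟨T, hTdef⟩ : ∃ T, T = univ.filter (fun i => Relevant A i ∨ Relevant B i) := ⟨_, rfl⟩
  rw [← hTdef] at hrel
  have hT : ∀ i, Relevant B i → i ∈ T := by
    intro i hi; rw [hTdef]; simp [hi]
  have hTC := tcross_of_cross hp r A B T hT hcross
  obtain ⟨z, hz⟩ : ∃ z : ∀ i, Fin (p i), ∀ i, (z i : ℕ) = 0 :=
    ⟨fun i => ⟨0, by have := hp i; omega⟩, fun i => rfl⟩
  have hpos : 0 < A.card * B.card := by
    have h1 := hmax {z} {z} (by
      intro x hx y hy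
      rw [mem_singleton] at hx hy
      subst hx; subst hy
      simpa using hrn)
    rw [card_singleton] at h1; omega
  obtain ⟨A', B', hA', hB', hC, hs⟩ := exists_compressed z hz T r _ A B rfl hTC
  have hAne : A'.Nonempty := card_pos.1 (by rw [hA']; exact Nat.pos_of_mul_pos_right hpos)
  have hBne : B'.Nonempty := card_pos.1 (by rw [hB']; exact Nat.pos_of_mul_pos_left hpos)
  have hz' := compressed_zero z T r A' B' hC hs
  have hrT : r ≤ T.card := by
    obtain ⟨x, hx⟩ := hAne
    obtain ⟨y, hy⟩ := hBne
    have := hz' x y hx hy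
    omega
  obtain ⟨S, a, b, hS, hle⟩ := good_main z r (T.card - r) A' B' T (by omega) (by omega) hAne hBne
    (by intro x hx y hy; have := hz' x y hx hy; omega)
  refine ⟨hBall S z a, hBall S z b, ⟨ball_cross z S r a b hS, ?_⟩, ⟨S, z, a, rfl⟩, ⟨S, z, b, rfl⟩⟩
  intro A'' B'' h
  refine (hmax A'' B'' h).trans ?_
  rw [← hA', ← hB']; exact hle
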